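/- Let n be an integer with 5 ≤ n ≤ 9, and set a = √(n−2)/(2√2) and b = (1/2)(6n − 12 − (n+2)√(2n−4)). Define A_i(x,t) = −σ_i(x)/(a|x|² − b t) for (x,t) ∈ ℝⁿ × (−∞,0). Then each A_i is smooth on all of ℝⁿ × (−∞,0); A solves the Yang-Mills flow equation ∂_t A_j = Σ_p (∂_p F_{pj} + A_p F_{pj} − F_{pj} A_p) at every point of ℝⁿ × (−∞,0); A satisfies the dilation condition A_i(x,t) = λ A_i(λx, λ²t) for every λ > 0; and the curvature F of A is not identically zero. In particular, A is a homothetically shrinking soliton of the Yang-Mills flow with non-zero curvature. -/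

import Mathlib

open MeasureTheory
open scoped BigOperators

namespace YangMillsFlow

noncomputable section

/-- Spacetime `ℝⁿ × ℝ`. -/
abbrev ST (n : ℕ) := (Fin n → ℝ) × ℝ

/-- `m × m` real matrices, modelled as functions. -/
abbrev Mat (m : ℕ) := Fin m → Fin m → ℝ

/-- Matrix multiplication. -/
def mmul {m : ℕ} (a b : Mat m) : Mat m := fun α β => ∑ γ, a α γ * b γ β

/-- The unit vector in the spatial direction `p`. -/
def spaceVec (n : ℕ) (p : Fin n) : ST n := (Pi.single p 1, 0)

/-- The unit vector in the time direction. -/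
def timeVec (n : ℕ) : ST n := (0, 1)

variable {n m : ℕ} {E : Type*} [NormedAddCommGroup E] [NormedSpace ℝ E]

/-- Spatial partial derivative `∂ₚ`. -/
def pd (p : Fin n) (f : ST n → E) (z : ST n) : E := fderiv ℝ f z (spaceVec n p)

/-- Time derivative `∂ₜ`. -/
def td (f : ST n → E) (z : ST n) : E := fderiv ℝ f z (timeVec n)

/-- Iterated spatial partial derivatives. -/
def iterPD : {k : ℕ} → (Fin k → Fin n) → (ST n → E) → ST n → E
  | 0, _, f => f
  | _ + 1, ps, f => iterPD (fun i => ps i.succ) (pd (ps 0) f)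

/-- The spatial Laplacian `Δ = ∑ₚ ∂ₚ²`. -/
def lap (f : ST n → ℝ) (z : ST n) : ℝ := ∑ p, pd p (fun w => pd p f w) z

/-- A time-dependent connection on the trivial bundle `ℝⁿ × ℝᵐ`. -/
abbrev Conn (n m : ℕ) := Fin n → ST n → Mat m

/-- The curvature `F_{ij} = ∂ᵢAⱼ - ∂ⱼAᵢ + AᵢAⱼ - AⱼAᵢ`. -/
def curv (A : Conn n m) (i j : Fin n) (z : ST n) : Mat m :=
  pd i (A j) z - pd j (A i) z + mmul (A i z) (A j z) - mmul (A j z) (A i z)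

/-- The covariant derivative of a `k`-tensor of matrices:
`(DT)_{p i₁ … i_k} = ∂ₚ T_{i₁ … i_k} + Aₚ T_{i₁ … i_k} - T_{i₁ … i_k} Aₚ`. -/
def covD (A : Conn n m) {k : ℕ} (T : (Fin k → Fin n) → ST n → Mat m) :
    (Fin (k + 1) → Fin n) → ST n → Mat m :=
  fun idx z =>
    pd (idx 0) (T (fun i => idx i.succ)) z
      + mmul (A (idx 0) z) (T (fun i => idx i.succ) z)
      - mmul (T (fun i => idx i.succ) z) (A (idx 0) z)

/-- The curvature as a `2`-tensor. -/
def curvT (A : Conn n m) : (Fin 2 → Fin n) → ST n → Mat m :=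
  fun idx z => curv A (idx 0) (idx 1) z

/-- The `k`-fold iterated covariant derivative `DᵏF` of the curvature (`D⁰F = F`). -/
def DkF (A : Conn n m) : (k : ℕ) → (Fin (k + 2) → Fin n) → ST n → Mat m
  | 0 => curvT A
  | k + 1 => covD A (DkF A k)

/-- The squared Frobenius norm of a matrix. -/
def matNormSq {m : ℕ} (M : Mat m) : ℝ := ∑ α, ∑ β, (M α β) ^ 2

/-- The squared pointwise norm of a `k`-tensor of matrices. -/
def tnormSq {k : ℕ} (T : (Fin k → Fin n) → ST n → Mat m) (z : ST n) : ℝ :=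
  ∑ idx : Fin k → Fin n, matNormSq (T idx z)

/-- `A` solves the Yang-Mills flow `∂ₜ Aⱼ = ∑ₚ (∂ₚ F_{pj} + Aₚ F_{pj} - F_{pj} Aₚ)` on `U`. -/
def IsYMFlow (A : Conn n m) (U : Set (ST n)) : Prop :=
  ∀ z ∈ U, ∀ j : Fin n,
    td (A j) z =
      ∑ p, (pd p (fun w => curv A p j w) z + mmul (A p z) (curv A p j z)
        - mmul (curv A p j z) (A p z))

/-- The connection `A` is smooth on the set `U`. -/
def SmoothConnOn (A : Conn n m) (U : Set (ST n)) : Prop :=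
  ∀ i, ContDiffOn ℝ (⊤ : ℕ∞) (A i) U

/-- The parabolic cylinder `P_r(X,T)`. -/
def pCyl (n : ℕ) (r : ℝ) (X : Fin n → ℝ) (T : ℝ) : Set (ST n) :=
  {z | Real.sqrt (∑ i, (z.1 i - X i) ^ 2) ≤ r ∧ T - r ^ 2 ≤ z.2 ∧ z.2 ≤ T}

/-- The backward heat kernel on `ℝⁿ` centred at `(X, T)`. -/
def backHeat (n : ℕ) (X : Fin n → ℝ) (T : ℝ) (z : ST n) : ℝ :=
  (4 * Real.pi * (T - z.2)) ^ (-(n : ℝ) / 2) *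
    Real.exp (-(∑ i, (z.1 i - X i) ^ 2) / (4 * (T - z.2)))

/-- `A` and all its spatial partial derivatives grow at most polynomially in `x`,
locally uniformly in `t` (for times in `J`). -/
def ModerateGrowth (A : Conn n m) (J : Set ℝ) : Prop :=
  ∀ i, ∀ (k : ℕ) (ps : Fin k → Fin n), ∀ t₀ t₁ : ℝ, ∃ C q : ℝ, ∀ z : ST n,
    z.2 ∈ J → t₀ ≤ z.2 → t₁ ≥ z.2 → ∀ α β,
      |iterPD ps (A i) z α β| ≤ C * (1 + ∑ j, (z.1 j) ^ 2) ^ q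

/-- The skew-symmetric matrix `σᵢ(x)` with entries `(σᵢ(x))^α_β = δᵢ^α x^β - δᵢ^β x^α`. -/
def sigmaM (n : ℕ) (i : Fin n) (x : Fin n → ℝ) : Mat n :=
  fun α β => (if i = α then x β else 0) - (if i = β then x α else 0)

open Filter Topology

/-! ### Algebra of the matrices `σᵢ` -/

/-- The matrix commutator as a bilinear map. -/
def commutator (m : ℕ) : Mat m →ₗ[ℝ] Mat m →ₗ[ℝ] Mat m :=
  LinearMap.mk₂ ℝ (fun a b => mmul a b - mmul b a)
    (fun a a' b => by
      ext α β
      simp only [mmul, Pi.add_apply, Pi.sub_apply, add_mul, mul_add, Finset.sum_add_distrib]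
      ring)
    (fun c a b => by
      ext α β
      simp only [mmul, Pi.smul_apply, Pi.sub_apply, smul_eq_mul, mul_sub, Finset.mul_sum]
      congr 1 <;> exact Finset.sum_congr rfl fun _ _ => by ring)
    (fun a b b' => by
      ext α β
      simp only [mmul, Pi.add_apply, Pi.sub_apply, add_mul, mul_add, Finset.sum_add_distrib]
      ring)
    (fun c a b => by
      ext α β
      simp only [mmul, Pi.smul_apply, Pi.sub_apply, smul_eq_mul, mul_sub, Finset.mul_sum]
      congr 1 <;> exact Finset.sum_congr rfl fun _ _ => by ring)

theorem commutator_apply (a b : Mat m) : commutator m a b = mmul a b - mmul b a := rfl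

/-- `σᵢ` as a linear map. -/
def sigmaL (n : ℕ) (i : Fin n) : (Fin n → ℝ) →ₗ[ℝ] Mat n where
  toFun := sigmaM n i
  map_add' x y := by
    ext α β
    simp only [sigmaM, Pi.add_apply]
    split_ifs <;> ring
  map_smul' c x := by
    ext α β
    simp only [sigmaM, Pi.smul_apply, smul_eq_mul, RingHom.id_apply]
    split_ifs <;> ring

theorem sigmaL_apply (i : Fin n) (x : Fin n → ℝ) : sigmaL n i x = sigmaM n i x := rfl

theorem sigmaM_smul (i : Fin n) (c : ℝ) (x : Fin n → ℝ) :
    sigmaM n i (c • x) = c • sigmaM n i x := (sigmaL n i).map_smul c x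

theorem sigmaM_single_swap (i j : Fin n) :
    sigmaM n i (Pi.single j 1) = -sigmaM n j (Pi.single i 1) := by
  ext α β
  simp only [sigmaM, Pi.single_apply, Pi.neg_apply, eq_comm (a := α), eq_comm (a := β)]
  split_ifs <;> ring

theorem sum_smul_sigmaM_single (j : Fin n) (x : Fin n → ℝ) :
    ∑ p, x p • sigmaM n j (Pi.single p 1) = sigmaM n j x := by
  simp only [← sigmaL_apply, ← map_smul, ← map_sum]
  congr 1
  ext q
  simp [Finset.sum_apply, Pi.single_apply]

theorem sum_smul_sigmaM_self (x : Fin n → ℝ) : ∑ p, x p • sigmaM n p x = 0 := by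
  ext α β
  simp only [Finset.sum_apply, Pi.smul_apply, smul_eq_mul, sigmaM, mul_sub,
    Finset.sum_sub_distrib, mul_ite, mul_zero, Finset.sum_ite_eq', Finset.mem_univ, if_true,
    Pi.zero_apply]
  ring

theorem mmul_sigmaM (i j : Fin n) (x y : Fin n → ℝ) (α β : Fin n) :
    mmul (sigmaM n i x) (sigmaM n j y) α β =
      (if i = α then 1 else 0) * x j * y β
        - (if i = α then 1 else 0) * (if j = β then 1 else 0) * ∑ γ, x γ * y γ
        - x α * (if i = j then 1 else 0) * y β + x α * (if j = β then 1 else 0) * y i := by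
  simp only [mmul, sigmaM, sub_mul, mul_sub, Finset.sum_sub_distrib, ite_mul, mul_ite, zero_mul,
    mul_zero, one_mul, mul_one, Finset.sum_ite_eq, Finset.mem_univ, if_true]
  split_ifs <;> simp_all <;> ring

theorem commutator_sigmaM (i j : Fin n) (x : Fin n → ℝ) :
    commutator n (sigmaM n i x) (sigmaM n j x) =
      x j • sigmaM n i x - x i • sigmaM n j x
        - (∑ k, (x k) ^ 2) • sigmaM n i (Pi.single j 1) := by
  ext α β
  simp only [commutator_apply, Pi.sub_apply, mmul_sigmaM, Pi.smul_apply, smul_eq_mul, sigmaM,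
    Pi.single_apply, ← pow_two, eq_comm (a := α), eq_comm (a := β), eq_comm (a := j) (b := i)]
  split_ifs <;> ring

theorem sum_commutator_sigmaM_single (j : Fin n) (x : Fin n → ℝ) :
    ∑ p, commutator n (sigmaM n p x) (sigmaM n p (Pi.single j 1)) =
      ((n : ℝ) - 2) • sigmaM n j x := by
  ext α β
  simp only [commutator_apply, Finset.sum_apply, Pi.sub_apply, mmul_sigmaM, Pi.smul_apply,
    smul_eq_mul, sigmaM, Pi.single_apply]
  simp [Finset.sum_add_distrib, Finset.sum_sub_distrib]
  simp only [eq_comm (a := β) (b := j), eq_comm (a := α) (b := j)]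
  split_ifs <;> ring

/-! ### The scalar profile -/

/-- The profile `φ(x,t) = -1/(a|x|² - bt)`. -/
def profile (a b : ℝ) (z : ST n) : ℝ := -(1 / (a * (∑ j, (z.1 j) ^ 2) - b * z.2))

theorem hasFDerivAt_coord (j : Fin n) (z : ST n) :
    HasFDerivAt (fun w : ST n => w.1 j)
      ((ContinuousLinearMap.proj (R := ℝ) (φ := fun _ : Fin n => ℝ) j).comp
        (ContinuousLinearMap.fst ℝ (Fin n → ℝ) ℝ)) z :=
  ((ContinuousLinearMap.proj (R := ℝ) (φ := fun _ : Fin n => ℝ) j).comp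
    (ContinuousLinearMap.fst ℝ (Fin n → ℝ) ℝ)).hasFDerivAt

theorem hasFDerivAt_quadratic (a b : ℝ) (z : ST n) :
    ∃ L : ST n →L[ℝ] ℝ,
      HasFDerivAt (fun w : ST n => a * (∑ j, (w.1 j) ^ 2) - b * w.2) L z ∧
      (∀ v, L v = 2 * a * (∑ j, z.1 j * v.1 j) - b * v.2) := by
  refine ⟨_, ((HasFDerivAt.fun_sum fun j _ => (hasFDerivAt_coord j z).pow 2).const_mul a).sub (hasFDerivAt_snd.const_mul b), ?_⟩
  intro v
  simp [Finset.mul_sum]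
  exact Finset.sum_congr rfl fun _ _ => by ring

theorem hasFDerivAt_profile {a b : ℝ} {z : ST n}
    (hz : a * (∑ j, (z.1 j) ^ 2) - b * z.2 ≠ 0) :
    ∃ L : ST n →L[ℝ] ℝ, HasFDerivAt (profile a b) L z ∧
      ∀ v, L v = profile a b z ^ 2 * (2 * a * (∑ j, z.1 j * v.1 j) - b * v.2) := by
  obtain ⟨L, hL, hv⟩ := hasFDerivAt_quadratic a b z
  have h := ((hasDerivAt_inv hz).comp_hasFDerivAt z hL).neg
  refine ⟨_, h.congr_of_eventuallyEq (Eventually.of_forall fun w => by simp [profile]), ?_⟩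
  intro v
  simp [hv, profile]

theorem hasFDerivAt_sigmaM (j : Fin n) (z : ST n) :
    ∃ L : ST n →L[ℝ] Mat n, HasFDerivAt (fun w : ST n => sigmaM n j w.1) L z ∧
      ∀ v, L v = sigmaM n j v.1 :=
  ⟨(LinearMap.toContinuousLinearMap (sigmaL n j)).comp (ContinuousLinearMap.fst ℝ (Fin n → ℝ) ℝ),
    ((LinearMap.toContinuousLinearMap (sigmaL n j)).comp
      (ContinuousLinearMap.fst ℝ (Fin n → ℝ) ℝ)).hasFDerivAt, fun _ => rfl⟩

theorem sum_mul_single (x : Fin n → ℝ) (p : Fin n) :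
    ∑ j, x j * (Pi.single p 1 : Fin n → ℝ) j = x p := by
  simp [Pi.single_apply]

/-! ### Curvature and the flow equation -/

/-- The connection `Aᵢ = φ σᵢ`. -/
def profileConn (n : ℕ) (a b : ℝ) : Conn n n := fun i z => profile a b z • sigmaM n i z.1

theorem fderiv_profileConn {a b : ℝ} {z : ST n}
    (hz : a * (∑ j, (z.1 j) ^ 2) - b * z.2 ≠ 0) (i : Fin n) (v : ST n) :
    fderiv ℝ (profileConn n a b i) z v =
      (profile a b z ^ 2 * (2 * a * (∑ j, z.1 j * v.1 j) - b * v.2)) • sigmaM n i z.1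
        + profile a b z • sigmaM n i v.1 := by
  obtain ⟨L, hL, hLv⟩ := hasFDerivAt_profile hz
  obtain ⟨M, hM, hMv⟩ := hasFDerivAt_sigmaM i z
  have h : HasFDerivAt (profileConn n a b i) _ z := hL.smul hM
  rw [h.fderiv]
  simp [hLv, hMv, add_comm]

theorem pd_profileConn {a b : ℝ} {z : ST n}
    (hz : a * (∑ j, (z.1 j) ^ 2) - b * z.2 ≠ 0) (p i : Fin n) :
    pd p (profileConn n a b i) z =
      (2 * a * profile a b z ^ 2 * z.1 p) • sigmaM n i z.1
        + profile a b z • sigmaM n i (Pi.single p 1) := by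
  rw [pd, fderiv_profileConn hz]
  simp only [spaceVec, sum_mul_single, mul_zero, sub_zero]
  congr 2
  ring

theorem td_profileConn {a b : ℝ} {z : ST n}
    (hz : a * (∑ j, (z.1 j) ^ 2) - b * z.2 ≠ 0) (i : Fin n) :
    td (profileConn n a b i) z = (-b * profile a b z ^ 2) • sigmaM n i z.1 := by
  have h0 : sigmaM n i 0 = 0 := (sigmaL n i).map_zero
  rw [td, fderiv_profileConn hz]
  simp only [timeVec, h0, smul_zero, add_zero, Pi.zero_apply, mul_zero, Finset.sum_const_zero]
  congr 1
  ring

theorem curv_profileConn {a b : ℝ} {z : ST n}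
    (hz : a * (∑ j, (z.1 j) ^ 2) - b * z.2 ≠ 0) (i j : Fin n) :
    curv (profileConn n a b) i j z =
      ((2 * a - 1) * profile a b z ^ 2) • (z.1 i • sigmaM n j z.1 - z.1 j • sigmaM n i z.1)
        - (2 * profile a b z + profile a b z ^ 2 * ∑ k, (z.1 k) ^ 2) •
          sigmaM n i (Pi.single j 1) := by
  rw [curv, add_sub_assoc, ← commutator_apply, pd_profileConn hz, pd_profileConn hz,
    sigmaM_single_swap j i]
  simp only [profileConn, map_smul, LinearMap.smul_apply, commutator_sigmaM]
  module

theorem pd_curv_profileConn {a b : ℝ} {z : ST n}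
    (hz : a * (∑ j, (z.1 j) ^ 2) - b * z.2 ≠ 0) (p j : Fin n) :
    pd p (fun w => curv (profileConn n a b) p j w) z =
      (4 * a * (2 * a - 1) * profile a b z ^ 3 * z.1 p) •
          (z.1 p • sigmaM n j z.1 - z.1 j • sigmaM n p z.1)
        + ((2 * a - 1) * profile a b z ^ 2) •
          (sigmaM n j z.1 + z.1 p • sigmaM n j (Pi.single p 1)
            - (Pi.single p 1 : Fin n → ℝ) j • sigmaM n p z.1)
        - ((4 * a * profile a b z ^ 2 + 2 * profile a b z ^ 2
            + 4 * a * profile a b z ^ 3 * ∑ k, (z.1 k) ^ 2) * z.1 p) •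
          sigmaM n p (Pi.single j 1) := by
  have hev : (fun w => curv (profileConn n a b) p j w) =ᶠ[𝓝 z] fun w =>
      ((2 * a - 1) * profile a b w ^ 2) • (w.1 p • sigmaM n j w.1 - w.1 j • sigmaM n p w.1)
        - (2 * profile a b w + profile a b w ^ 2 * ∑ k, (w.1 k) ^ 2) •
          sigmaM n p (Pi.single j 1) := by
    obtain ⟨L, hL, -⟩ := hasFDerivAt_quadratic a b z
    filter_upwards [hL.continuousAt.eventually_ne hz] with w hw
    exact curv_profileConn hw p j
  obtain ⟨L, hL, hLv⟩ := hasFDerivAt_profile hz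
  obtain ⟨R, hR, hRv⟩ := hasFDerivAt_quadratic 1 0 z
  obtain ⟨M, hM, hMv⟩ := hasFDerivAt_sigmaM j z
  obtain ⟨N, hN, hNv⟩ := hasFDerivAt_sigmaM p z
  simp only [one_mul, zero_mul, sub_zero] at hR
  have hd := (((hL.pow 2).const_mul (2 * a - 1)).smul
    (((hasFDerivAt_coord p z).smul hM).sub ((hasFDerivAt_coord j z).smul hN))).sub
    (((hL.const_mul 2).add ((hL.pow 2).mul hR)).smul_const (sigmaM n p (Pi.single j 1)))
  have hpp : sigmaM n p (Pi.single p 1) = 0 := self_eq_neg.mp (sigmaM_single_swap p p)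
  rw [pd, hev.fderiv_eq]
  refine (congrArg (fun T => T (spaceVec n p)) hd.fderiv).trans ?_
  simp [hLv, hRv, hMv, hNv, spaceVec, sum_mul_single, hpp]
  module

theorem isYMFlow_profileConn {a b : ℝ} (ha : 8 * a ^ 2 = (n : ℝ) - 2)
    (hb : b = 3 * (n : ℝ) - 6 - 2 * a * ((n : ℝ) + 2)) {U : Set (ST n)}
    (hU : ∀ z ∈ U, a * (∑ j, (z.1 j) ^ 2) - b * z.2 ≠ 0) :
    IsYMFlow (profileConn n a b) U := by
  intro z hzU j
  have hz := hU z hzU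
  set φ := profile a b z with hφ
  set r := ∑ k, (z.1 k) ^ 2 with hr
  set P := (2 * a - 1) * φ ^ 2 with hP
  set Q := 2 * φ + φ ^ 2 * r with hQ
  set P' := 4 * a * (2 * a - 1) * φ ^ 3 with hP'
  set Q' := 4 * a * φ ^ 2 + 2 * φ ^ 2 + 4 * a * φ ^ 3 * r with hQ'
  have hterm : ∀ p : Fin n,
      pd p (fun w => curv (profileConn n a b) p j w) z
          + mmul (profileConn n a b p z) (curv (profileConn n a b) p j z)
          - mmul (curv (profileConn n a b) p j z) (profileConn n a b p z) =
        (P' * (z.1 p) ^ 2 + P) • sigmaM n j z.1 - (P' * z.1 j) • (z.1 p • sigmaM n p z.1)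
          + (P + Q') • (z.1 p • sigmaM n j (Pi.single p 1))
          - P • ((Pi.single j 1 : Fin n → ℝ) p • sigmaM n p z.1)
          + (φ * P) • commutator n (z.1 p • sigmaM n p z.1) (sigmaM n j z.1)
          - (φ * Q) • commutator n (sigmaM n p z.1) (sigmaM n p (Pi.single j 1)) := by
    intro p
    have hself : commutator n (sigmaM n p z.1) (sigmaM n p z.1) = 0 := sub_self _
    have hsing : (Pi.single p 1 : Fin n → ℝ) j = (Pi.single j 1 : Fin n → ℝ) p := by
      simp [Pi.single_apply, eq_comm]
    rw [add_sub_assoc, ← commutator_apply, pd_curv_profileConn hz, curv_profileConn hz,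
      sigmaM_single_swap p j, hsing]
    simp only [profileConn, map_smul, map_sub, map_neg, LinearMap.smul_apply, hself, ← hφ, ← hr,
      ← hP, ← hQ, ← hP', ← hQ']
    module
  have hdelta : ∑ p, (Pi.single j 1 : Fin n → ℝ) p • sigmaM n p z.1 = sigmaM n j z.1 := by
    simp [Pi.single_apply]
  have hcomm : ∑ p, commutator n (z.1 p • sigmaM n p z.1) (sigmaM n j z.1) = 0 := by
    rw [← LinearMap.sum_apply, ← map_sum, sum_smul_sigmaM_self, map_zero, LinearMap.zero_apply]
  rw [td_profileConn hz, Finset.sum_congr rfl fun p _ => hterm p]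
  simp only [Finset.sum_add_distrib, Finset.sum_sub_distrib, ← Finset.smul_sum, ← Finset.sum_smul,
    ← Finset.mul_sum, sum_smul_sigmaM_self, sum_smul_sigmaM_single, hdelta, hcomm,
    sum_commutator_sigmaM_single, ← hr, ← hφ, Finset.sum_const, Finset.card_univ, Fintype.card_fin,
    nsmul_eq_mul, smul_zero, sub_zero, add_zero]
  simp only [smul_smul, ← add_smul, ← sub_smul]
  congr 1
  rw [hP, hQ, hP', hQ', hb]
  linear_combination (-φ ^ 3 * r) * ha

theorem contDiffOn_profileConn {a b : ℝ} {U : Set (ST n)}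
    (hU : ∀ z ∈ U, a * (∑ j, (z.1 j) ^ 2) - b * z.2 ≠ 0) (i : Fin n) :
    ContDiffOn ℝ (⊤ : ℕ∞) (profileConn n a b i) U := by
  have hg : ContDiff ℝ (⊤ : ℕ∞) fun w : ST n => a * (∑ j, (w.1 j) ^ 2) - b * w.2 := by fun_prop
  have hσ : ContDiff ℝ (⊤ : ℕ∞) fun w : ST n => sigmaM n i w.1 :=
    ((LinearMap.toContinuousLinearMap (sigmaL n i)).comp
      (ContinuousLinearMap.fst ℝ (Fin n → ℝ) ℝ)).contDiff
  exact ((contDiffOn_const.div hg.contDiffOn hU).neg).smul hσ.contDiffOn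

theorem profileConn_dilation (a b : ℝ) {lam : ℝ} (hlam : 0 < lam) (i : Fin n) (z : ST n) :
    profileConn n a b i z = lam • profileConn n a b i (lam • z.1, lam ^ 2 * z.2) := by
  have hden : a * (∑ j, ((lam • z.1) j) ^ 2) - b * (lam ^ 2 * z.2) =
      lam ^ 2 * (a * (∑ j, (z.1 j) ^ 2) - b * z.2) := by
    simp only [Pi.smul_apply, smul_eq_mul, mul_pow, ← Finset.mul_sum]
    ring
  simp only [profileConn, profile, hden, sigmaM_smul, smul_smul]
  congr 1
  rw [one_div, one_div, mul_inv]
  field_simp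

theorem curv_profileConn_ne_zero (a : ℝ) {b : ℝ} (hb : b ≠ 0) {i j : Fin n} (hij : i ≠ j) :
    curv (profileConn n a b) i j (0, -1) ≠ 0 := by
  have hz : a * (∑ j, (((0, -1) : ST n).1 j) ^ 2) - b * ((0, -1) : ST n).2 ≠ 0 := by simpa using hb
  intro h
  rw [curv_profileConn hz] at h
  have hentry := congrFun (congrFun h i) j
  simp [profile, sigmaM, hij, hb] at hentry

/-- `Aᵢ(x,t) = -σᵢ(x)/(a|x|² - bt)` is a smooth homothetically
shrinking soliton of the Yang-Mills flow with non-zero curvature, for `5 ≤ n ≤ 9`. -/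
theorem explicit_shrinking_soliton (n : ℕ) (hn5 : 5 ≤ n) (hn9 : n ≤ 9) (a b : ℝ)
    (ha : a = Real.sqrt ((n : ℝ) - 2) / (2 * Real.sqrt 2))
    (hb : b = (6 * (n : ℝ) - 12 - ((n : ℝ) + 2) * Real.sqrt (2 * (n : ℝ) - 4)) / 2)
    (A : Conn n n)
    (hA : ∀ (i : Fin n) (z : ST n), A i z =
      (-(1 / (a * (∑ j, (z.1 j) ^ 2) - b * z.2))) • sigmaM n i z.1) :
    (∀ i, ContDiffOn ℝ (⊤ : ℕ∞) (A i) {z : ST n | z.2 < 0}) ∧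
    IsYMFlow A {z : ST n | z.2 < 0} ∧
    (∀ lam : ℝ, 0 < lam → ∀ (i : Fin n) (z : ST n), z.2 < 0 →
      A i z = lam • A i (lam • z.1, lam ^ 2 * z.2)) ∧
    (∃ (i j : Fin n) (z : ST n), z.2 < 0 ∧ curv A i j z ≠ 0) := by
  have hn5' : (5 : ℝ) ≤ n := by exact_mod_cast hn5
  have hn9' : (n : ℝ) ≤ 9 := by exact_mod_cast hn9
  obtain rfl : A = profileConn n a b := by
    funext i z
    exact hA i z
  have hs2 : 0 < Real.sqrt 2 := by positivity
  have hsn : 0 < Real.sqrt ((n : ℝ) - 2) := Real.sqrt_pos.mpr (by linarith)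
  have ha0 : 0 < a := by rw [ha]; positivity
  have ha2 : 8 * a ^ 2 = (n : ℝ) - 2 := by
    rw [ha, div_pow, mul_pow, Real.sq_sqrt (by linarith), Real.sq_sqrt (by norm_num)]
    ring
  have hroot : Real.sqrt (2 * (n : ℝ) - 4) = 4 * a := by
    rw [Real.sqrt_eq_iff_mul_self_eq (by linarith) (by positivity)]
    linarith
  have hb' : b = 3 * (n : ℝ) - 6 - 2 * a * ((n : ℝ) + 2) := by
    rw [hb, hroot]
    ring
  have hb0 : 0 < b := by
    have hfac : b = 8 * a * (2 * a - 1) * (1 - a) := by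
      rw [hb']
      linear_combination (-3 + 2 * a) * ha2
    have h1 : 0 < 2 * a - 1 := by nlinarith
    have h2 : 0 < 1 - a := by nlinarith
    rw [hfac]
    positivity
  have hU : ∀ z ∈ {z : ST n | z.2 < 0}, a * (∑ j, (z.1 j) ^ 2) - b * z.2 ≠ 0 := by
    intro z hz
    have h1 : 0 ≤ a * ∑ j, (z.1 j) ^ 2 := by positivity
    have h2 : b * z.2 < 0 := mul_neg_of_pos_of_neg hb0 hz
    linarith
  refine ⟨contDiffOn_profileConn hU, isYMFlow_profileConn ha2 hb' hU,
    fun lam hlam i z _ => profileConn_dilation a b hlam i z,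
    ⟨0, by omega⟩, ⟨1, by omega⟩, (0, -1), by simp, curv_profileConn_ne_zero a hb0.ne' ?_⟩
  simp

end

end YangMillsFlow
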